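/- Let G = (V,(V_a)_{a∈Σ},(E_a)_{a∈Σ}) be a Σ-labeled digraph, P₁ a path over Σ, and ℓ a fresh label not in Σ. Let G' be the (Σ∪{ℓ})-labeled digraph with the same nodes and node labels as G, with E_a unchanged for a∈Σ, and with E_ℓ = ⟦P₁⟧_G. Then for every path P over Σ: (1) ⟦P⟧_{G'} = ⟦P⟧_G, and (2) if P' is obtained from P by replacing occurrences of the subquery P₁ by edge_ℓ, then ⟦P'⟧_{G'} = ⟦P⟧_G; in particular the answer sets with respect to any start set S coincide: ⟦P'⟧_{G'}(S) = ⟦P⟧_G(S). -/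

import Mathlib

namespace NRPQ

/- Syntax of nested regular path queries: filters and paths, by mutual recursion. -/
mutual
inductive Filter (σ : Type) : Type where
  | test : Path σ → Filter σ              -- [P]
  | top : Filter σ                        -- ⊤ (true, all nodes)
  | lab : σ → Filter σ                    -- node label a
  | and : Filter σ → Filter σ → Filter σ
  | or : Filter σ → Filter σ → Filter σ
  | not : Filter σ → Filter σ
inductive Path (σ : Type) : Type where
  | filt : Filter σ → Path σ              -- [F]?
  | edge : σ → Path σ                     -- edge_a
  | edgeInv : σ → Path σ                  -- edge_a⁻¹
  | comp : Path σ → Path σ → Path σ       -- P/P'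
  | union : Path σ → Path σ → Path σ      -- P ∪ P'
  | plus : Path σ → Path σ                -- P⁺
  | goto : Filter σ → Path σ              -- goto(F)
end

/-- A Σ-labeled digraph: a finite set of nodes, a-labeled node sets and a-labeled edge sets. -/
structure Graph (σ α : Type) where
  V : Set α
  finV : V.Finite
  labNodes : σ → Set α
  labNodes_sub : ∀ a, labNodes a ⊆ V
  edges : σ → Set (α × α)
  edges_sub : ∀ a, edges a ⊆ V ×ˢ V

variable {σ α : Type}

/- Semantics of filters (sets of nodes) and paths (binary relations), by mutual recursion. -/
mutual
def filterSem (G : Graph σ α) : Filter σ → Set α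
  | .test P => {v | ∃ v', (v, v') ∈ pathSem G P}
  | .top => G.V
  | .lab a => G.labNodes a
  | .and F F' => filterSem G F ∩ filterSem G F'
  | .or F F' => filterSem G F ∪ filterSem G F'
  | .not F => G.V \ filterSem G F
def pathSem (G : Graph σ α) : Path σ → Set (α × α)
  | .filt F => {p | p.1 = p.2 ∧ p.1 ∈ filterSem G F}
  | .edge a => G.edges a
  | .edgeInv a => {p | (p.2, p.1) ∈ G.edges a}
  | .comp P P' => {p | ∃ w, (p.1, w) ∈ pathSem G P ∧ (w, p.2) ∈ pathSem G P'}
  | .union P P' => pathSem G P ∪ pathSem G P'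
  | .plus P => {p | Relation.TransGen (fun v w => (v, w) ∈ pathSem G P) p.1 p.2}
  | .goto F => {p | p.1 ∈ G.V ∧ p.2 ∈ filterSem G F}
end

/-- ⟦P⟧(S): the nodes reachable over path `P` from some node of the start set `S`. -/
def pathSemS (G : Graph σ α) (P : Path σ) (S : Set α) : Set α :=
  {v | ∃ v' ∈ S, (v', v) ∈ pathSem G P}

/-- ⟦F⟧(S): the nodes of the start set `S` satisfying the filter `F`. -/
def filterSemS (G : Graph σ α) (F : Filter σ) (S : Set α) : Set α :=
  filterSem G F ∩ S

end NRPQ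
namespace NRPQ

variable {σ σ' : Type}

/- Relabeling of filters and paths along a function on labels (used to view a
query over Σ as a query over the enriched signature Σ ∪ {ℓ}). -/
mutual
def Filter.map (g : σ → σ') : Filter σ → Filter σ'
  | .test P => .test (P.map g)
  | .top => .top
  | .lab a => .lab (g a)
  | .and F F' => .and (F.map g) (F'.map g)
  | .or F F' => .or (F.map g) (F'.map g)
  | .not F => .not (F.map g)
def Path.map (g : σ → σ') : Path σ → Path σ'
  | .filt F => .filt (F.map g)
  | .edge a => .edge (g a)
  | .edgeInv a => .edgeInv (g a)
  | .comp P P' => .comp (P.map g) (P'.map g)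
  | .union P P' => .union (P.map g) (P'.map g)
  | .plus P => .plus (P.map g)
  | .goto F => .goto (F.map g)
end

/- `ReplacesP P₁ P P'` holds iff the path P' over the enriched signature
Σ ⊕ Unit is obtained from the path P over Σ by replacing occurrences of the
subquery P₁ by the edge query edge_ℓ for the fresh index label ℓ = Sum.inr (),
and renaming every remaining label a to Sum.inl a. -/
mutual
inductive ReplacesF (P₁ : Path σ) : Filter σ → Filter (σ ⊕ Unit) → Prop where
  | test {P P'} : ReplacesP P₁ P P' → ReplacesF P₁ (.test P) (.test P')
  | top : ReplacesF P₁ .top .top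
  | lab (a : σ) : ReplacesF P₁ (.lab a) (.lab (Sum.inl a))
  | and {F F' G G'} : ReplacesF P₁ F G → ReplacesF P₁ F' G' →
      ReplacesF P₁ (.and F F') (.and G G')
  | or {F F' G G'} : ReplacesF P₁ F G → ReplacesF P₁ F' G' →
      ReplacesF P₁ (.or F F') (.or G G')
  | not {F G} : ReplacesF P₁ F G → ReplacesF P₁ (.not F) (.not G)
inductive ReplacesP (P₁ : Path σ) : Path σ → Path (σ ⊕ Unit) → Prop where
  | base : ReplacesP P₁ P₁ (.edge (Sum.inr ()))
  | filt {F G} : ReplacesF P₁ F G → ReplacesP P₁ (.filt F) (.filt G)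
  | edge (a : σ) : ReplacesP P₁ (.edge a) (.edge (Sum.inl a))
  | edgeInv (a : σ) : ReplacesP P₁ (.edgeInv a) (.edgeInv (Sum.inl a))
  | comp {P P' Q Q'} : ReplacesP P₁ P Q → ReplacesP P₁ P' Q' →
      ReplacesP P₁ (.comp P P') (.comp Q Q')
  | union {P P' Q Q'} : ReplacesP P₁ P Q → ReplacesP P₁ P' Q' →
      ReplacesP P₁ (.union P P') (.union Q Q')
  | plus {P Q} : ReplacesP P₁ P Q → ReplacesP P₁ (.plus P) (.plus Q)
  | goto {F G} : ReplacesF P₁ F G → ReplacesP P₁ (.goto F) (.goto G)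
end

/- Viewing a query over Σ as a query over Σ ∪ {ℓ} is the rewriting that replaces nothing. -/
mutual
theorem ReplacesF.map_inl (P₁ : Path σ) : ∀ F : Filter σ, ReplacesF P₁ F (F.map Sum.inl)
  | .test P => by simpa only [Filter.map] using .test (ReplacesP.map_inl P₁ P)
  | .top => by simpa only [Filter.map] using .top
  | .lab a => by simpa only [Filter.map] using .lab a
  | .and F F' => by
      simpa only [Filter.map] using .and (ReplacesF.map_inl P₁ F) (ReplacesF.map_inl P₁ F')
  | .or F F' => by
      simpa only [Filter.map] using .or (ReplacesF.map_inl P₁ F) (ReplacesF.map_inl P₁ F')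
  | .not F => by simpa only [Filter.map] using .not (ReplacesF.map_inl P₁ F)
theorem ReplacesP.map_inl (P₁ : Path σ) : ∀ P : Path σ, ReplacesP P₁ P (P.map Sum.inl)
  | .filt F => by simpa only [Path.map] using .filt (ReplacesF.map_inl P₁ F)
  | .edge a => by simpa only [Path.map] using .edge a
  | .edgeInv a => by simpa only [Path.map] using .edgeInv a
  | .comp P P' => by
      simpa only [Path.map] using .comp (ReplacesP.map_inl P₁ P) (ReplacesP.map_inl P₁ P')
  | .union P P' => by
      simpa only [Path.map] using .union (ReplacesP.map_inl P₁ P) (ReplacesP.map_inl P₁ P')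
  | .plus P => by simpa only [Path.map] using .plus (ReplacesP.map_inl P₁ P)
  | .goto F => by simpa only [Path.map] using .goto (ReplacesF.map_inl P₁ F)
end

/-- Rewriting a path preserves its semantics on the graph enriched with index edges. -/
theorem ReplacesP.pathSem_eq {α : Type} {G : Graph σ α} {P₁ : Path σ} {G' : Graph (σ ⊕ Unit) α}
    (hV : G'.V = G.V)
    (hlab : ∀ a : σ, G'.labNodes (Sum.inl a) = G.labNodes a)
    (hedge : ∀ a : σ, G'.edges (Sum.inl a) = G.edges a)
    (hidx : G'.edges (Sum.inr ()) = pathSem G P₁)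
    {P : Path σ} {P' : Path (σ ⊕ Unit)} (h : ReplacesP P₁ P P') :
    pathSem G' P' = pathSem G P := by
  induction h using ReplacesP.rec
    (motive_1 := fun F F' _ => filterSem G' F' = filterSem G F) with
  | base => simpa only [pathSem] using hidx
  | _ => simp_all only [pathSem, filterSem]

/-- correctness of jumping with indexes: let G' be the graph over
the enriched signature Σ ∪ {ℓ} with the same nodes, node labels and edges as G,
plus the index edges E_ℓ = ⟦P₁⟧_G. Then (1) every path query over Σ has the same
semantics on G' as on G, and (2) rewriting a query by replacing occurrences of
the subquery P₁ by edge_ℓ preserves its semantics, in particular its answer set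
for every start set S. -/
theorem jumping_correct (σ α : Type) (G : Graph σ α) (P₁ : Path σ)
    (G' : Graph (σ ⊕ Unit) α)
    (hV : G'.V = G.V)
    (hlab : ∀ a : σ, G'.labNodes (Sum.inl a) = G.labNodes a)
    (hlabℓ : G'.labNodes (Sum.inr ()) = ∅)
    (hedge : ∀ a : σ, G'.edges (Sum.inl a) = G.edges a)
    (hidx : G'.edges (Sum.inr ()) = pathSem G P₁) :
    (∀ P : Path σ, pathSem G' (P.map Sum.inl) = pathSem G P) ∧
    (∀ (P : Path σ) (P' : Path (σ ⊕ Unit)), ReplacesP P₁ P P' →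
      pathSem G' P' = pathSem G P ∧
      ∀ S : Set α, pathSemS G' P' S = pathSemS G P S) := by
  have key : ∀ (P : Path σ) (P' : Path (σ ⊕ Unit)), ReplacesP P₁ P P' →
      pathSem G' P' = pathSem G P :=
    fun _ _ h => h.pathSem_eq hV hlab hedge hidx
  refine ⟨fun P => key P _ (ReplacesP.map_inl P₁ P), fun P P' h => ⟨key P P' h, fun S => ?_⟩⟩
  simp only [pathSemS, key P P' h]

end NRPQ
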